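/- Let K and M be positive integers with 1 ≤ M ≤ ⌈√(K/2 + 9/16) + 3/4⌉ and M ≤ K. Then, with respect to the even partition of the K nodes into W = M nonempty groups (each group of size ⌊K/M⌋ or ⌈K/M⌉), there exists an (M,K,L)-schedule sequence set whose period satisfies L ≤ 2M·(2⌈K/M⌉ + 2)·(4⌈K/M⌉ + 2). -/

import Mathlib

/-- A schedule symbol for a system with `W` channels: `T m` means "transmit on
channel `m`" and `R r` means "receive on channel `r`". -/
inductive SchedSym (W : ℕ) where
  | T : Fin W → SchedSym W
  | R : Fin W → SchedSym W
deriving DecidableEq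

/-- `IsScheduleSet W K L G s` says that `s` is an `(M,K,L)`-schedule sequence set
(for any number of channels `M ≥ W`) with respect to the partition of the `K` nodes
into the `W` groups given by the group-assignment map `G` (node `i` lies in group
`G i`). Sequences are modeled as `ℕ → SchedSym W`, indexed modulo `L`.

* `own_channel`: a node in group `m` only uses the transmit symbol `T m`;
* `intra`: intra-group requirement (eq. (1) of the paper) for all offsets `τ ∈ Z_L^K`;
* `inter`: inter-group requirement (eq. (2) of the paper) for all offsets `τ ∈ Z_L^K`. -/
structure IsScheduleSet (W K L : ℕ) (G : Fin K → Fin W)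
    (s : Fin K → ℕ → SchedSym W) : Prop where
  own_channel : ∀ (i : Fin K) (t : ℕ) (m : Fin W), s i t = SchedSym.T m → m = G i
  intra : ∀ τ : Fin K → ℕ, (∀ i, τ i < L) → ∀ i j : Fin K, i ≠ j → G i = G j →
    ∃ t < L, s i ((t + τ i) % L) = SchedSym.T (G i) ∧
      s j ((t + τ j) % L) = SchedSym.R (G i) ∧
      ∀ x : Fin K, x ≠ i → x ≠ j → G x = G i → s x ((t + τ x) % L) ≠ SchedSym.T (G i)
  inter : ∀ τ : Fin K → ℕ, (∀ i, τ i < L) → ∀ i j : Fin K, G i ≠ G j →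
    ∃ t < L, s i ((t + τ i) % L) = SchedSym.T (G i) ∧
      s j ((t + τ j) % L) = SchedSym.R (G i) ∧
      ∀ x : Fin K, x ≠ i → G x = G i → s x ((t + τ x) % L) ≠ SchedSym.T (G i)

/-- The size of group `m` under the group-assignment map `G`. -/
def groupSize {W K : ℕ} (G : Fin K → Fin W) (m : Fin W) : ℕ :=
  (Finset.univ.filter (fun i => G i = m)).card

open Polynomial in
/-- A nonconstant polynomial of degree at most three over a field has at most three roots,
and at most two if its cubic coefficient vanishes. -/
lemma card_cubic_roots_le {F : Type*} [Field F] (a b c d : F) (S : Finset F)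
    (hS : ∀ z ∈ S, a * z ^ 3 + b * z ^ 2 + c * z + d = 0) (hne : a ≠ 0 ∨ b ≠ 0 ∨ c ≠ 0) :
    S.card ≤ 3 ∧ (a = 0 → S.card ≤ 2) := by
  classical
  set P : F[X] := C a * X ^ 3 + C b * X ^ 2 + C c * X + C d with hP
  have hP0 : P ≠ 0 := by
    intro h
    have h3 : P.coeff 3 = a := by simp [hP]
    have h2 : P.coeff 2 = b := by simp [hP]
    have h1 : P.coeff 1 = c := by simp [hP, coeff_C]
    rw [h, coeff_zero] at h1 h2 h3
    rcases hne with h | h | h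
    · exact h h3.symm
    · exact h h2.symm
    · exact h h1.symm
  have hle : S.card ≤ P.natDegree := by
    refine Polynomial.card_le_degree_of_subset_roots (p := P) ?_
    intro z hz
    rw [Polynomial.mem_roots hP0]
    simpa [hP, IsRoot] using hS z hz
  refine ⟨hle.trans (by rw [hP]; compute_degree), fun ha => hle.trans ?_⟩
  rw [hP, ha]
  simp only [map_zero, zero_mul, zero_add]
  compute_degree

/-- The transmission pattern, modulo `p * q`, of the cubic `a * X ^ 3 + b * X` restricted to the
window `{0, …, w - 1}`: the residue modulo `q` lies in the window and the residue
modulo `p` is the value of the cubic there. -/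
def CubicPattern (p q w : ℕ) (a b : ZMod p) (u : ℕ) : Prop :=
  u % q < w ∧ (u : ZMod p) = a * ((u % q : ℕ) : ZMod p) ^ 3 + b * ((u % q : ℕ) : ZMod p)

lemma cubicPattern_mod_iff {p q w : ℕ} {a b : ZMod p} {u : ℕ} :
    CubicPattern p q w a b (u % (p * q)) ↔ CubicPattern p q w a b u := by
  have h : ((u % (p * q) : ℕ) : ZMod p) = (u : ZMod p) := by
    rw [ZMod.natCast_eq_natCast_iff]
    exact (Nat.mod_modEq u (p * q)).of_mul_right q
  unfold CubicPattern
  rw [Nat.mod_mul_left_mod, h]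

lemma natCast_zmod_injOn {p m n : ℕ} (hm : m < p) (hn : n < p)
    (h : (m : ZMod p) = n) : m = n := by
  rw [ZMod.natCast_eq_natCast_iff] at h
  exact h.eq_of_lt_of_lt hm hn

/-- Two distinct cubic patterns, under arbitrary shifts, collide at most three times, and at most
twice if their leading coefficients agree. Here `v` parametrises the first pattern by its window. -/
lemma card_collisions_le {p q w : ℕ} [Fact p.Prime] (hp3 : 3 < p) (hwp : w < p)
    (hq : 2 * w - 1 ≤ q) {a b a' b' : ZMod p} (ha' : a' ≠ 0) (hab : a ≠ a' ∨ b ≠ b')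
    (e e' : ℕ) (v : ℕ → ℕ) (S : Finset ℕ)
    (hvq : ∀ k ∈ S, k < w ∧ (v k + e) % q = k ∧
      ((v k + e : ℕ) : ZMod p) = a * (k : ZMod p) ^ 3 + b * (k : ZMod p))
    (hS : ∀ k ∈ S, CubicPattern p q w a' b' (v k + e')) :
    S.card ≤ 3 ∧ (a = a' → S.card ≤ 2) := by
  classical
  rcases S.eq_empty_or_nonempty with rfl | ⟨k₀, hk₀⟩
  · simp
  set c : ℤ := (((v k₀ + e') % q : ℕ) : ℤ) - k₀ with hc
  have hcw : |c| < w := by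
    have h1 := (hvq k₀ hk₀).1
    have h2 := (hS k₀ hk₀).1
    rw [abs_lt]; constructor <;> omega
  have hshift : ∀ k ∈ S, (((v k + e') % q : ℕ) : ℤ) = k + c := by
    intro k hk
    have h1 := hvq k₀ hk₀
    have h2 := (hS k₀ hk₀).1
    have h3 := hvq k hk
    have h4 := (hS k hk).1
    have hdvd : (q : ℤ) ∣ (((v k + e') % q : ℕ) : ℤ) - k - c := by
      have d1 := Int.mod_modEq ((v k + e' : ℕ) : ℤ) q
      have d2 := Int.mod_modEq ((v k₀ + e' : ℕ) : ℤ) q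
      have d3 := Int.mod_modEq ((v k + e : ℕ) : ℤ) q
      have d4 := Int.mod_modEq ((v k₀ + e : ℕ) : ℤ) q
      rw [← Int.natCast_mod] at d1 d2 d3 d4
      rw [h3.2.1] at d3
      rw [h1.2.1] at d4
      have d := ((d1.sub d3).sub (d2.sub d4)).symm.dvd
      have hz : ((v k + e' : ℕ) : ℤ) - ((v k + e : ℕ) : ℤ) -
          (((v k₀ + e' : ℕ) : ℤ) - ((v k₀ + e : ℕ) : ℤ)) = 0 := by push_cast; ring
      rwa [hz, sub_zero] at d
    have hlt : |(((v k + e') % q : ℕ) : ℤ) - k - c| < q := by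
      have h1' := h1.1
      have h3' := h3.1
      rw [abs_lt]; constructor <;> omega
    have := Int.eq_zero_of_abs_lt_dvd hdvd hlt
    omega
  have hinj : Set.InjOn (fun k : ℕ => (k : ZMod p)) S := fun k hk l hl h =>
    natCast_zmod_injOn ((hvq k hk).1.trans hwp) ((hvq l hl).1.trans hwp) h
  rw [← Finset.card_image_of_injOn hinj]
  have key := card_cubic_roots_le (a - a') (-(3 * a' * (c : ZMod p)))
    (b - b' - 3 * a' * (c : ZMod p) ^ 2)
    (-(a' * (c : ZMod p) ^ 3) - b' * c + e' - e) (S.image (fun k : ℕ => (k : ZMod p))) ?_ ?_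
  · exact ⟨key.1, fun h => key.2 (sub_eq_zero.2 h)⟩
  · intro z hz
    obtain ⟨k, hk, rfl⟩ := Finset.mem_image.1 hz
    have h1 := (hvq k hk).2.2
    have h2 := (hS k hk).2
    have h3 : (((v k + e') % q : ℕ) : ZMod p) = (k : ZMod p) + (c : ZMod p) := by
      have := congrArg (Int.cast : ℤ → ZMod p) (hshift k hk)
      push_cast at this ⊢
      exact_mod_cast this
    rw [h3] at h2
    push_cast at h1 h2
    linear_combination h2 - h1
  · by_cases h : a = a'
    · have hb : b ≠ b' := hab.resolve_left (not_not.2 h)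
      right
      by_cases h0 : c = 0
      · right
        simpa [h0] using sub_ne_zero.2 hb
      · left
        have h3 : (3 : ZMod p) ≠ 0 := by
          intro h
          have : ((3 : ℕ) : ZMod p) = 0 := by exact_mod_cast h
          rw [ZMod.natCast_eq_zero_iff] at this
          exact absurd (Nat.le_of_dvd (by norm_num) this) (by omega)
        have hc0 : (c : ZMod p) ≠ 0 := by
          intro h
          rw [ZMod.intCast_zmod_eq_zero_iff_dvd] at h
          exact h0 (Int.eq_zero_of_abs_lt_dvd h (by omega))
        exact neg_ne_zero.2 (mul_ne_zero (mul_ne_zero h3 ha') hc0)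
    · left
      exact sub_ne_zero.2 h

/-- Chinese remainder theorem with a shift: some `u < p * q` places `u + e` at the point of a
cubic pattern lying over the window position `k`. -/
lemma exists_shifted_point {p q : ℕ} [NeZero p] (hq : 0 < q) (hpq : p.Coprime q)
    (y : ZMod p) (e k : ℕ) (hk : k < q) :
    ∃ u < p * q, (u + e) % q = k ∧ ((u + e : ℕ) : ZMod p) = y := by
  obtain ⟨z, hz₁, hz₂⟩ := Nat.chineseRemainder hpq y.val k
  have hpos : 0 < p * q := Nat.mul_pos (NeZero.pos p) hq
  have hmod : (z + p * q * e - e) % (p * q) + e ≡ z [MOD p * q] := by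
    have h := (Nat.mod_modEq (z + p * q * e - e) (p * q)).add_right e
    have hle : e ≤ p * q * e := Nat.le_mul_of_pos_left e hpos
    rw [Nat.sub_add_cancel (by omega)] at h
    refine h.trans ?_
    simp [Nat.ModEq]
  refine ⟨(z + p * q * e - e) % (p * q), Nat.mod_lt _ hpos, ?_, ?_⟩
  · have h := (hmod.of_mul_left p).trans hz₂
    rw [Nat.ModEq, Nat.mod_eq_of_lt hk] at h
    exact h
  · have h := (hmod.of_mul_right q).trans hz₁
    rw [(ZMod.natCast_eq_natCast_iff _ _ _).2 h, ZMod.natCast_zmod_val]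

/-- Irrepressibility of the cubic patterns: if fewer than `g` other users share the leading
coefficient of `i`, then under arbitrary shifts some transmission of `i` avoids all of these users
and one further user `j`. -/
lemma exists_collision_free {ι : Type*} [Fintype ι] [DecidableEq ι] {p g : ℕ} [Fact p.Prime]
    (hgp : 2 * g + 2 < p) (hp3 : 3 < p) (hpq : p.Coprime (4 * g + 3))
    (a b : ι → ZMod p) (ha : ∀ x, a x ≠ 0)
    (hab : ∀ x y, x ≠ y → a x ≠ a y ∨ b x ≠ b y) (e : ι → ℕ) (i j : ι) (hij : i ≠ j)
    (C : Finset ι) (hi : i ∉ C) (hC : ∀ x ∈ C, a x = a i) (hcard : C.card < g) :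
    ∃ u < p * (4 * g + 3),
      CubicPattern p (4 * g + 3) (2 * g + 2) (a i) (b i) (u + e i) ∧
      ¬ CubicPattern p (4 * g + 3) (2 * g + 2) (a j) (b j) (u + e j) ∧
      ∀ x ∈ C, ¬ CubicPattern p (4 * g + 3) (2 * g + 2) (a x) (b x) (u + e x) := by
  classical
  have hpt : ∀ k : ℕ, ∃ u, k < 2 * g + 2 → u < p * (4 * g + 3) ∧ (u + e i) % (4 * g + 3) = k ∧
      ((u + e i : ℕ) : ZMod p) = a i * (k : ZMod p) ^ 3 + b i * (k : ZMod p) := by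
    intro k
    by_cases hk : k < 2 * g + 2
    · obtain ⟨u, hu⟩ := exists_shifted_point (q := 4 * g + 3) (by omega) hpq
        (a i * (k : ZMod p) ^ 3 + b i * (k : ZMod p)) (e i) k (by omega)
      exact ⟨u, fun _ => hu⟩
    · exact ⟨0, fun h => absurd h hk⟩
  choose v hv using hpt
  let B : ι → Finset ℕ := fun x => (Finset.range (2 * g + 2)).filter
    (fun k => CubicPattern p (4 * g + 3) (2 * g + 2) (a x) (b x) (v k + e x))
  have hB : ∀ x, x ≠ i → (B x).card ≤ 3 ∧ (a i = a x → (B x).card ≤ 2) := by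
    intro x hx
    refine card_collisions_le (q := 4 * g + 3) hp3 hgp (by omega) (ha x) (hab i x hx.symm)
      (e i) (e x) v (B x) ?_ ?_
    · intro k hk
      have hk' : k < 2 * g + 2 := Finset.mem_range.1 (Finset.mem_filter.1 hk).1
      exact ⟨hk', (hv k hk').2⟩
    · intro k hk
      exact (Finset.mem_filter.1 hk).2
  have hlt : (C.biUnion B ∪ B j).card < (Finset.range (2 * g + 2)).card := by
    have h1 : (C.biUnion B).card ≤ C.card * 2 := Finset.card_biUnion_le_card_mul _ _ _
      fun x hx => (hB x (fun h => hi (h ▸ hx))).2 (hC x hx).symm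
    have h2 := (hB j hij.symm).1
    have h3 := Finset.card_union_le (C.biUnion B) (B j)
    rw [Finset.card_range]
    omega
  obtain ⟨k, hk, hkB⟩ := Finset.exists_mem_notMem_of_card_lt_card hlt
  have hk' := Finset.mem_range.1 hk
  obtain ⟨hu, hmod, hval⟩ := hv k hk'
  refine ⟨v k, hu, ⟨by omega, by rw [hmod]; exact hval⟩, ?_, ?_⟩
  · intro h
    exact hkB (Finset.mem_union_right _ (Finset.mem_filter.2 ⟨hk, h⟩))
  · intro x hx h
    exact hkB (Finset.mem_union_left _ (Finset.mem_biUnion.2 ⟨x, hx, Finset.mem_filter.2 ⟨hk, h⟩⟩))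

/-- Assign the node `i` to the group `i % M`. -/
def residueGroup (K M : ℕ) (hM : 0 < M) (i : Fin K) : Fin M := ⟨i % M, Nat.mod_lt _ hM⟩

lemma groupSize_residueGroup {K M : ℕ} (hM : 0 < M) (m : Fin M) :
    groupSize (residueGroup K M hM) m = K / M ∨
      groupSize (residueGroup K M hM) m = K / M + 1 ∧ 0 < K % M := by
  have h : groupSize (residueGroup K M hM) m = K.count (· ≡ m [MOD M]) := by
    rw [Nat.count_eq_card_filter_range, groupSize, ← Finset.card_map Fin.valEmbedding]
    congr 1
    ext n
    simp only [Finset.mem_map, Finset.mem_filter, Finset.mem_univ, true_and, residueGroup,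
      Fin.ext_iff, Fin.valEmbedding_apply, Finset.mem_range, Nat.ModEq, Nat.mod_eq_of_lt m.2]
    constructor
    · rintro ⟨a, ha, rfl⟩
      exact ⟨a.2, ha⟩
    · rintro ⟨hn, h⟩
      exact ⟨⟨n, hn⟩, h, rfl⟩
  rw [h, Nat.count_modEq_card K hM]
  split_ifs with h
  · right; exact ⟨rfl, by omega⟩
  · left; rfl

lemma ceilDiv_eq_of_mod_pos {K M : ℕ} (hM : 0 < M) (h : 0 < K % M) :
    (K + M - 1) / M = K / M + 1 := by
  have h1 := Nat.div_add_mod K M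
  have h2 : K + M - 1 = (K % M - 1) + M * (K / M + 1) := by rw [mul_add]; omega
  rw [h2, Nat.add_mul_div_left _ _ hM, Nat.div_eq_of_lt, zero_add]
  have := Nat.mod_lt K hM
  omega

/-- The schedule which cycles through the receive channels and transmits on its own channel in
every frame of length `M` singled out by a cubic pattern. -/
noncomputable def cubicSchedule {M : ℕ} (hM : 0 < M) (p q w : ℕ) (a b : ZMod p) (m : Fin M)
    (t : ℕ) : SchedSym M :=
  open Classical in
  if CubicPattern p q w a b (t / M) then SchedSym.T m else SchedSym.R ⟨t % M, Nat.mod_lt _ hM⟩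

lemma cubicSchedule_mod {M : ℕ} (hM : 0 < M) (p q w : ℕ) (a b : ZMod p) (m : Fin M) (t : ℕ) :
    cubicSchedule hM p q w a b m (t % (M * (p * q))) = cubicSchedule hM p q w a b m t := by
  have h : CubicPattern p q w a b (t % (M * (p * q)) / M) ↔ CubicPattern p q w a b (t / M) := by
    rw [Nat.mod_mul_right_div_self, cubicPattern_mod_iff]
  by_cases hu : CubicPattern p q w a b (t / M)
  · rw [cubicSchedule, cubicSchedule, if_pos hu, if_pos (h.2 hu)]
  · rw [cubicSchedule, cubicSchedule, if_neg hu, if_neg (mt h.1 hu)]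
    simp only [Nat.mod_mul_right_mod]

lemma cubicSchedule_eq_T_iff {M : ℕ} (hM : 0 < M) {p q w : ℕ} {a b : ZMod p} {m n : Fin M}
    {t : ℕ} : cubicSchedule hM p q w a b m t = SchedSym.T n ↔
      CubicPattern p q w a b (t / M) ∧ m = n := by
  unfold cubicSchedule
  split_ifs with h <;> simp [h]

lemma exists_frame_position {M : ℕ} (τ r : ℕ) (hr : r < M) : ∃ c < M, (c + τ) % M = r := by
  have hM : 0 < M := by omega
  refine ⟨(r + M * τ - τ) % M, Nat.mod_lt _ hM, ?_⟩
  have hle : τ ≤ M * τ := Nat.le_mul_of_pos_left τ hM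
  rw [Nat.mod_add_mod, Nat.sub_add_cancel (by omega), Nat.add_mul_mod_self_left,
    Nat.mod_eq_of_lt hr]

/-- The bound on the number of channels in terms of the maximal group size. -/
lemma channels_le_of_le_ceil_sqrt {K M g : ℕ} (hg : 0 < g) (hKg : K ≤ g * M)
    (hM' : (M : ℤ) ≤ ⌈Real.sqrt ((K : ℝ) / 2 + 9 / 16) + 3 / 4⌉) : M ≤ 2 * g + 2 := by
  by_contra! hlt
  rw [Int.le_ceil_iff] at hM'
  push_cast at hM'
  have hMr : (2 * g + 3 : ℝ) ≤ M := by exact_mod_cast hlt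
  have hgr : (1 : ℝ) ≤ g := by exact_mod_cast hg
  have hKr : (K : ℝ) ≤ g * M := by exact_mod_cast hKg
  have hs : (M : ℝ) - 7 / 4 < Real.sqrt ((K : ℝ) / 2 + 9 / 16) := by linarith
  rw [Real.lt_sqrt (by linarith)] at hs
  nlinarith

/-- Proposition on the period under even group division: let `K, M`
be positive integers with `M ≤ K` and `M ≤ ⌈√(K/2 + 9/16) + 3/4⌉`. Then with respect
to an even partition of the `K` nodes into `W = M` nonempty groups (every group of
size `⌊K/M⌋` or `⌈K/M⌉`, the latter written as `(K + M − 1)/M` in natural-number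
arithmetic), there exists an `(M,K,L)`-schedule sequence set with period
`L ≤ 2M(2⌈K/M⌉ + 2)(4⌈K/M⌉ + 2)`. -/
theorem construction_star_even_division
    (K M : ℕ) (hK : 0 < K) (hM : 0 < M) (hMK : M ≤ K)
    (hM' : (M : ℤ) ≤ ⌈Real.sqrt ((K : ℝ) / 2 + 9 / 16) + 3 / 4⌉) :
    ∃ (L : ℕ) (G : Fin K → Fin M) (s : Fin K → ℕ → SchedSym M),
      0 < L ∧ Function.Surjective G ∧
      (∀ m : Fin M, groupSize G m = K / M ∨ groupSize G m = (K + M - 1) / M) ∧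
      IsScheduleSet M K L G s ∧
      (L : ℤ) ≤ 2 * M * (2 * ⌈(K : ℚ) / (M : ℚ)⌉ + 2) * (4 * ⌈(K : ℚ) / (M : ℚ)⌉ + 2) := by
  obtain ⟨g, hg⟩ : ∃ g, g = (K + M - 1) / M := ⟨_, rfl⟩
  have hg0 : 0 < g := hg ▸ Nat.div_pos (by omega) hM
  have hKg : K ≤ g * M := by
    have h := Nat.lt_mul_div_succ (K + M - 1) hM
    rw [← hg, mul_add, mul_comm] at h
    omega
  have hgK : g * M < K + M := by
    have h := Nat.div_mul_le_self (K + M - 1) M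
    rw [← hg] at h
    omega
  have hMg := channels_le_of_le_ceil_sqrt hg0 hKg hM'
  obtain ⟨p, hp, hp1, hp2⟩ := Nat.exists_prime_lt_and_le_two_mul (2 * g + 1) (by omega)
  have : Fact p.Prime := ⟨hp⟩
  have hodd : p % 2 = 1 := hp.eq_two_or_odd.resolve_left (by omega)
  have hgp : 2 * g + 2 < p := by omega
  have hpq : p.Coprime (4 * g + 3) := by
    rw [hp.coprime_iff_not_dvd]
    rintro ⟨c, hc⟩
    have h1 : 1 < c := by
      by_contra! h
      have := Nat.mul_le_mul_left p h
      omega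
    have := Nat.mul_le_mul_left p (show 2 ≤ c from h1)
    omega
  have hsize : ∀ m : Fin M, groupSize (residueGroup K M hM) m = K / M ∨
      groupSize (residueGroup K M hM) m = (K + M - 1) / M := by
    intro m
    rcases groupSize_residueGroup (K := K) hM m with h | ⟨h, hpos⟩
    · exact Or.inl h
    · exact Or.inr (h.trans (ceilDiv_eq_of_mod_pos hM hpos).symm)
  let a : Fin K → ZMod p := fun i => ((i % M + 1 : ℕ) : ZMod p)
  let b : Fin K → ZMod p := fun i => ((i / M : ℕ) : ZMod p)
  have ha : ∀ x, a x ≠ 0 := by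
    intro x h
    have hlt := Nat.mod_lt (x : ℕ) hM
    have := natCast_zmod_injOn (p := p) (by omega) hp.pos (h.trans Nat.cast_zero.symm)
    omega
  have hab : ∀ x y, x ≠ y → a x ≠ a y ∨ b x ≠ b y := by
    intro x y hxy
    by_contra! h
    have hb : ∀ z : Fin K, (z : ℕ) / M < p := fun z => by
      have : (z : ℕ) / M < g := Nat.div_lt_of_lt_mul (by have := z.2; rw [mul_comm]; omega)
      omega
    have h1 := Nat.mod_lt (x : ℕ) hM
    have h2 := Nat.mod_lt (y : ℕ) hM
    have e1 := natCast_zmod_injOn (by omega) (by omega) h.1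
    have e2 := natCast_zmod_injOn (hb x) (hb y) h.2
    refine hxy (Fin.ext ?_)
    rw [← Nat.div_add_mod (x : ℕ) M, ← Nat.div_add_mod (y : ℕ) M, e2, Nat.succ_injective e1]
  let s : Fin K → ℕ → SchedSym M := fun i =>
    cubicSchedule hM p (4 * g + 3) (2 * g + 2) (a i) (b i) (residueGroup K M hM i)
  have main : ∀ (τ : Fin K → ℕ) (i j : Fin K), i ≠ j →
      ∃ t < M * (p * (4 * g + 3)),
        s i ((t + τ i) % (M * (p * (4 * g + 3)))) = SchedSym.T (residueGroup K M hM i) ∧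
        s j ((t + τ j) % (M * (p * (4 * g + 3)))) = SchedSym.R (residueGroup K M hM i) ∧
        ∀ x : Fin K, x ≠ i → residueGroup K M hM x = residueGroup K M hM i →
          s x ((t + τ x) % (M * (p * (4 * g + 3)))) ≠ SchedSym.T (residueGroup K M hM i) := by
    intro τ i j hij
    obtain ⟨c, hc, hcr⟩ := exists_frame_position (τ j) (i % M) (Nat.mod_lt _ hM)
    let C := (Finset.univ.filter
      (fun x => residueGroup K M hM x = residueGroup K M hM i)).erase i
    have hcard : C.card < g := by
      have hi : i ∈ Finset.univ.filter
        (fun x => residueGroup K M hM x = residueGroup K M hM i) := by simp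
      have h1 := Finset.card_erase_lt_of_mem hi
      have h2 : groupSize (residueGroup K M hM) (residueGroup K M hM i) ≤ g := by
        have : K / M ≤ (K + M - 1) / M := Nat.div_le_div_right (by omega)
        rcases hsize (residueGroup K M hM i) with h | h <;> omega
      exact h1.trans_le h2
    obtain ⟨u, hu, hui, huj, hux⟩ := exists_collision_free hgp (by omega) hpq a b ha hab
      (fun x => (c + τ x) / M) i j hij C (Finset.notMem_erase _ _)
      (fun x hx => by
        have h := (Finset.mem_filter.1 (Finset.mem_of_mem_erase hx)).2
        have h' : (x : ℕ) % M = i % M := congrArg Fin.val h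
        simp only [a, h']) hcard
    have hdiv : ∀ x, (M * u + c + τ x) / M = u + (c + τ x) / M := fun x => by
      rw [add_assoc, Nat.mul_add_div hM]
    refine ⟨M * u + c, ?_, ?_, ?_, ?_⟩
    · have := Nat.mul_le_mul_left M (Nat.succ_le_of_lt hu)
      rw [Nat.mul_succ] at this
      omega
    · simp only [s]
      rw [cubicSchedule_mod, cubicSchedule_eq_T_iff, hdiv]
      exact ⟨hui, rfl⟩
    · simp only [s]
      rw [cubicSchedule_mod, cubicSchedule, hdiv, if_neg huj]
      simp only [residueGroup, add_assoc, Nat.mul_add_mod, hcr]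
    · intro x hx hG
      simp only [s]
      rw [cubicSchedule_mod, Ne, cubicSchedule_eq_T_iff, hdiv]
      exact fun h => hux x (Finset.mem_erase.2 ⟨hx, Finset.mem_filter.2 ⟨Finset.mem_univ _, hG⟩⟩) h.1
  refine ⟨M * (p * (4 * g + 3)), residueGroup K M hM, s, ?_, ?_, hsize, ⟨?_, ?_, ?_⟩, ?_⟩
  · exact Nat.mul_pos hM (Nat.mul_pos hp.pos (by omega))
  · intro m
    exact ⟨⟨m, m.2.trans_le hMK⟩, Fin.ext (Nat.mod_eq_of_lt m.2)⟩
  · intro i t m h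
    exact ((cubicSchedule_eq_T_iff hM).1 h).2.symm
  · intro τ _ i j hij _
    obtain ⟨t, ht, h1, h2, h3⟩ := main τ i j hij
    exact ⟨t, ht, h1, h2, fun x hxi _ => h3 x hxi⟩
  · intro τ _ i j hG
    exact main τ i j (fun h => hG (congrArg _ h))
  · have hceil : (g : ℤ) ≤ ⌈(K : ℚ) / (M : ℚ)⌉ := by
      rw [Int.le_ceil_iff, lt_div_iff₀ (by exact_mod_cast hM)]
      have : (g : ℚ) * M < K + M := by exact_mod_cast hgK
      push_cast
      linarith
    have hL : M * (p * (4 * g + 3)) ≤ 2 * M * (2 * g + 2) * (4 * g + 2) := by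
      have h1 : p * (4 * g + 3) ≤ (4 * g + 2) * (4 * g + 4) :=
        Nat.mul_le_mul (by omega) (by omega)
      calc M * (p * (4 * g + 3)) ≤ M * ((4 * g + 2) * (4 * g + 4)) := Nat.mul_le_mul_left M h1
        _ = 2 * M * (2 * g + 2) * (4 * g + 2) := by ring
    calc ((M * (p * (4 * g + 3)) : ℕ) : ℤ) ≤ 2 * M * (2 * g + 2) * (4 * g + 2) := by
          exact_mod_cast hL
      _ ≤ _ := by gcongr
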